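/- Let R and W be relations on a set Q, let G = gfp(λY. W ∩ g̃(Y)) where g̃(Y) = ¬(¬Y ∘ R⁻¹), and let R_good = R ∩ G. Then (R_good)⁺ ⊆ W, where ⁺ denotes transitive closure. -/

import Mathlib

/-- Composition of relations viewed as subsets of `Q × Q`:
`relComp X R = {(s,s') | ∃ s₁, (s,s₁) ∈ X ∧ (s₁,s') ∈ R}`. -/
def relComp {Q : Type*} (X R : Set (Q × Q)) : Set (Q × Q) :=
  {p | ∃ s₁, (p.1, s₁) ∈ X ∧ (s₁, p.2) ∈ R}

/-- Inverse of a relation: `relInv R = {(s',s) | (s,s') ∈ R}`. -/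
def relInv {Q : Type*} (R : Set (Q × Q)) : Set (Q × Q) :=
  {p | (p.2, p.1) ∈ R}

/-- `gtilde R Y = ¬(¬Y ∘ R⁻¹)`. -/
def gtilde {Q : Type*} (R Y : Set (Q × Q)) : Set (Q × Q) :=
  (relComp Yᶜ (relInv R))ᶜ

theorem relComp_mono {Q : Type*} {X X' : Set (Q × Q)} (R : Set (Q × Q)) (h : X ⊆ X') :
    relComp X R ⊆ relComp X' R := fun _ ⟨s₁, h1, h2⟩ => ⟨s₁, h h1, h2⟩

/-- The monotone map `Y ↦ S ∪ (Y ∘ R)`. -/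
def fwd {Q : Type*} (R S : Set (Q × Q)) : Set (Q × Q) →o Set (Q × Q) :=
  ⟨fun Y => S ∪ relComp Y R,
   fun _ _ h => Set.union_subset_union subset_rfl (relComp_mono R h)⟩

/-- The monotone map `Y ↦ W ∩ ¬(¬Y ∘ R⁻¹)`. -/
def bwd {Q : Type*} (R W : Set (Q × Q)) : Set (Q × Q) →o Set (Q × Q) :=
  ⟨fun Y => W ∩ gtilde R Y,
   fun _ _ h => Set.inter_subset_inter subset_rfl
     (Set.compl_subset_compl.2 (relComp_mono (relInv R) (Set.compl_subset_compl.2 h)))⟩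

/-- Transitive closure of a relation viewed as a subset of `Q × Q`. -/
def transClos {Q : Type*} (R : Set (Q × Q)) : Set (Q × Q) :=
  {p | Relation.TransGen (fun a b => (a, b) ∈ R) p.1 p.2}

/-- Reflexive-transitive closure of a relation viewed as a subset of `Q × Q`. -/
def reflTransClos {Q : Type*} (R : Set (Q × Q)) : Set (Q × Q) :=
  {p | Relation.ReflTransGen (fun a b => (a, b) ∈ R) p.1 p.2}

/-- The greatest fixpoint of `bwd R W` is closed under forward `R`-steps. -/
theorem mem_gfp_bwd_of_step {Q : Type*} {R W : Set (Q × Q)} {a b c : Q}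
    (h : (a, b) ∈ OrderHom.gfp (bwd R W)) (hbc : (b, c) ∈ R) :
    (a, c) ∈ OrderHom.gfp (bwd R W) := by
  rw [← OrderHom.map_gfp] at h
  by_contra hac
  exact h.2 ⟨c, hac, hbc⟩

theorem gfp_bwd_subset {Q : Type*} (R W : Set (Q × Q)) :
    OrderHom.gfp (bwd R W) ⊆ W := by
  intro p hp
  rw [← OrderHom.map_gfp] at hp
  exact hp.1

/-- with G = gfp (λ Y. W ∩ g̃ Y) and R_good = R ∩ G, (R_good)⁺ ⊆ W. -/
theorem stmt9 {Q : Type*} (R W : Set (Q × Q)) :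
    transClos (R ∩ OrderHom.gfp (bwd R W)) ⊆ W := by
  rintro ⟨a, b⟩ h
  apply gfp_bwd_subset R W
  change Relation.TransGen _ a b at h
  induction h with
  | single h => exact h.2
  | tail _ hbc ih => exact mem_gfp_bwd_of_step ih hbc.1
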